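/- There is no real polynomial P of degree 8 that defines the sign pattern (+,+,+,−,−,+,−,+,+), has no negative real roots, and has exactly four positive real roots, each simple. In other words, the sign pattern (+,+,+,−,−,+,−,+,+) is not realizable with the admissible pair (4,0). -/

import Mathlib

open Polynomial

/-- A degree-8 real polynomial `P` defines the sign pattern `σ = (σ_0, …, σ_8)`
(with entries `1` for `+`, `-1` for `−`) if for each `j` the coefficient of
`x^(8-j)` is nonzero and has sign `σ_j`. -/
def definesSignPattern (P : Polynomial ℝ) (σ : Fin 9 → ℝ) : Prop :=
  ∀ j : Fin 9, Real.sign (P.coeff (8 - (j : ℕ))) = σ j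

/-- A linear recurrent sequence whose characteristic polynomial has the distinct roots `p, s, q`
annihilates the coefficients of every polynomial of degree at most `8` vanishing at `p, s, q`. -/
lemma sum_coeff_mul_recurrence_eq_zero {p s q : ℝ} (hps : p ≠ s) (hsq : s ≠ q) (hpq : p ≠ q)
    (a F : ℕ → ℝ)
    (hF : ∀ k, F (k + 3) =
      (p + s + q) * F (k + 2) - (p * s + p * q + s * q) * F (k + 1) + p * s * q * F k)
    (hp : ∑ k ∈ Finset.range 9, a k * p ^ k = 0)
    (hs : ∑ k ∈ Finset.range 9, a k * s ^ k = 0)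
    (hq : ∑ k ∈ Finset.range 9, a k * q ^ k = 0) :
    ∑ k ∈ Finset.range 9, a k * F k = 0 := by
  set A := (q - s) * (F 2 - (s + q) * F 1 + s * q * F 0) with hA
  set B := -(q - p) * (F 2 - (p + q) * F 1 + p * q * F 0) with hB
  set C := (s - p) * (F 2 - (p + s) * F 1 + p * s * F 0) with hC
  have hD : (s - p) * (q - s) * (q - p) ≠ 0 :=
    mul_ne_zero (mul_ne_zero (sub_ne_zero.2 hps.symm) (sub_ne_zero.2 hsq.symm))
      (sub_ne_zero.2 hpq.symm)
  have key : ∀ k, (s - p) * (q - s) * (q - p) * F k = A * p ^ k + B * s ^ k + C * q ^ k ∧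
      (s - p) * (q - s) * (q - p) * F (k + 1)
        = A * p ^ (k + 1) + B * s ^ (k + 1) + C * q ^ (k + 1) ∧
      (s - p) * (q - s) * (q - p) * F (k + 2)
        = A * p ^ (k + 2) + B * s ^ (k + 2) + C * q ^ (k + 2) := by
    intro k
    induction k with
    | zero =>
      refine ⟨?_, ?_, ?_⟩ <;> simp only [hA, hB, hC] <;> ring
    | succ k ih =>
      obtain ⟨h0, h1, h2⟩ := ih
      refine ⟨h1, h2, ?_⟩
      rw [show k + 1 + 2 = k + 3 from rfl, hF k]
      linear_combination (p + s + q) * h2 - (p * s + p * q + s * q) * h1 + p * s * q * h0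
  have hsum : (s - p) * (q - s) * (q - p) * ∑ k ∈ Finset.range 9, a k * F k
      = A * ∑ k ∈ Finset.range 9, a k * p ^ k + B * ∑ k ∈ Finset.range 9, a k * s ^ k
        + C * ∑ k ∈ Finset.range 9, a k * q ^ k := by
    simp only [Finset.mul_sum, ← Finset.sum_add_distrib]
    refine Finset.sum_congr rfl fun k _ => ?_
    linear_combination a k * (key k).1
  rw [hp, hs, hq] at hsum
  simpa [hD] using hsum

/-- The sequence with initial values `u, v, w` satisfying
`F (k + 3) = e₁ F (k + 2) - e₂ F (k + 1) + e₃ F k`. -/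
def cubicRecurrence (e₁ e₂ e₃ u v w : ℝ) : ℕ → ℝ
  | 0 => u
  | 1 => v
  | 2 => w
  | k + 3 => e₁ * cubicRecurrence e₁ e₂ e₃ u v w (k + 2)
      - e₂ * cubicRecurrence e₁ e₂ e₃ u v w (k + 1) + e₃ * cubicRecurrence e₁ e₂ e₃ u v w k

/-- A degree `8` polynomial with sign pattern `(+,+,+,?,-,?,-,+,+)` having three positive roots
`p < s < q` is negative at the point `-2 (p + s) / 5`. -/
lemma sum_coeff_neg_of_three_pos_roots {p s q : ℝ} (hp0 : 0 < p) (hps : p < s) (hsq : s < q)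
    (a : ℕ → ℝ) (h0 : 0 < a 0) (h1 : 0 < a 1) (h2 : a 2 < 0) (h4 : a 4 < 0)
    (h6 : 0 < a 6) (h7 : 0 < a 7) (h8 : 0 < a 8)
    (hp : ∑ k ∈ Finset.range 9, a k * p ^ k = 0)
    (hs : ∑ k ∈ Finset.range 9, a k * s ^ k = 0)
    (hq : ∑ k ∈ Finset.range 9, a k * q ^ k = 0) :
    ∑ k ∈ Finset.range 9, a k * (-(2 / 5 * (p + s))) ^ k < 0 := by
  obtain ⟨x, hx, rfl⟩ : ∃ x, 0 < x ∧ s = p + x := ⟨s - p, by linarith, by ring⟩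
  obtain ⟨y, hy, rfl⟩ : ∃ y, 0 < y ∧ q = p + x + y := ⟨q - (p + x), by linarith, by ring⟩
  set t := 2 / 5 * (p + (p + x)) with ht
  set e₁ := p + (p + x) + (p + x + y) with he₁
  set e₂ := p * (p + x) + p * (p + x + y) + (p + x) * (p + x + y) with he₂
  set e₃ := p * (p + x) * (p + x + y) with he₃
  set v := (t ^ 2 + e₂ - e₁ ^ 2) * e₃ with hv
  set u := e₁ * e₃ + e₂ * (t ^ 2 + e₂ - e₁ ^ 2) with hu
  set F := cubicRecurrence e₁ e₂ e₃ u v 0 with hF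
  have hsum := sum_coeff_mul_recurrence_eq_zero hps.ne hsq.ne (hps.trans hsq).ne a F
    (fun k => by simp only [hF, cubicRecurrence, he₁, he₂, he₃]) hp hs hq
  have htpos : 0 < t := by positivity
  have he₁pos : 0 < e₁ := by positivity
  have he₂pos : 0 < e₂ := by positivity
  have he₃pos : 0 < e₃ := by positivity
  have F0 : F 0 = u := rfl
  have F1 : F 1 = v := rfl
  have F2 : F 2 = 0 := rfl
  have R3 : F 3 = e₁ * F 2 - e₂ * F 1 + e₃ * F 0 := rfl
  have R4 : F 4 = e₁ * F 3 - e₂ * F 2 + e₃ * F 1 := rfl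
  have R5 : F 5 = e₁ * F 4 - e₂ * F 3 + e₃ * F 2 := rfl
  have R6 : F 6 = e₁ * F 5 - e₂ * F 4 + e₃ * F 3 := rfl
  have R7 : F 7 = e₁ * F 6 - e₂ * F 5 + e₃ * F 4 := rfl
  have R8 : F 8 = e₁ * F 7 - e₂ * F 6 + e₃ * F 5 := rfl
  have F3 : F 3 = e₃ ^ 2 * e₁ := by rw [R3, F2, F1, F0, hv, hu]; ring
  have F4 : F 4 = e₃ ^ 2 * (t ^ 2 + e₂) := by rw [R4, F3, F2, F1, hv]; ring
  have F5 : F 5 = e₃ ^ 2 * (e₁ * t ^ 2) := by rw [R5, F4, F3, F2]; ring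
  have F6 : F 6 = e₃ ^ 2 * (e₁ * (e₁ * t ^ 2) - e₂ * (t ^ 2 + e₂) + e₃ * e₁) := by
    rw [R6, F5, F4, F3]; ring
  have F7 : F 7 = e₃ ^ 2 * (e₁ * (e₁ * (e₁ * t ^ 2) - e₂ * (t ^ 2 + e₂) + e₃ * e₁)
      - e₂ * (e₁ * t ^ 2) + e₃ * (t ^ 2 + e₂)) := by
    rw [R7, F6, F5, F4]; ring
  have F8 : F 8 = e₃ ^ 2 * (e₁ * (e₁ * (e₁ * (e₁ * t ^ 2) - e₂ * (t ^ 2 + e₂) + e₃ * e₁)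
      - e₂ * (e₁ * t ^ 2) + e₃ * (t ^ 2 + e₂))
      - e₂ * (e₁ * (e₁ * t ^ 2) - e₂ * (t ^ 2 + e₂) + e₃ * e₁) + e₃ * (e₁ * t ^ 2)) := by
    rw [R8, F7, F6, F5]; ring
  have w0 : 0 < -(t ^ 3 * F 0 + e₁ * e₃ ^ 2) := by
    rw [F0]; simp only [hu, ht, he₁, he₂, he₃]; ring_nf; positivity
  have w1 : 0 < -v := by
    simp only [hv, ht, he₁, he₂, he₃]; ring_nf; positivity
  have w6 : 0 < -(e₁ * (e₁ * t ^ 2) - e₂ * (t ^ 2 + e₂) + e₃ * e₁) - e₁ * t ^ 3 := by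
    simp only [ht, he₁, he₂, he₃]; ring_nf; positivity
  have w7 : 0 < -(e₁ * (e₁ * (e₁ * t ^ 2) - e₂ * (t ^ 2 + e₂) + e₃ * e₁)
      - e₂ * (e₁ * t ^ 2) + e₃ * (t ^ 2 + e₂)) := by
    simp only [ht, he₁, he₂, he₃]; ring_nf; positivity
  have w8 : 0 < -(e₁ * (e₁ * (e₁ * (e₁ * t ^ 2) - e₂ * (t ^ 2 + e₂) + e₃ * e₁)
      - e₂ * (e₁ * t ^ 2) + e₃ * (t ^ 2 + e₂))
      - e₂ * (e₁ * (e₁ * t ^ 2) - e₂ * (t ^ 2 + e₂) + e₃ * e₁) + e₃ * (e₁ * t ^ 2))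
      - e₁ * t ^ 5 := by
    simp only [ht, he₁, he₂, he₃]; ring_nf; positivity
  clear_value F t e₁ e₂ e₃ u v
  have hident : e₁ * e₃ ^ 2 * ∑ k ∈ Finset.range 9, a k * (-t) ^ k
      = ∑ k ∈ Finset.range 9, a k * (t ^ 3 * F k + e₁ * e₃ ^ 2 * (-t) ^ k) := by
    have : ∑ k ∈ Finset.range 9, a k * (t ^ 3 * F k + e₁ * e₃ ^ 2 * (-t) ^ k)
        = t ^ 3 * ∑ k ∈ Finset.range 9, a k * F k
          + e₁ * e₃ ^ 2 * ∑ k ∈ Finset.range 9, a k * (-t) ^ k := by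
      simp only [Finset.mul_sum, ← Finset.sum_add_distrib]
      exact Finset.sum_congr rfl fun k _ => by ring
    rw [this, hsum]; ring
  have T0 : a 0 * (t ^ 3 * F 0 + e₁ * e₃ ^ 2 * (-t) ^ 0) < 0 :=
    mul_neg_of_pos_of_neg h0 (by linarith)
  have T1 : a 1 * (t ^ 3 * F 1 + e₁ * e₃ ^ 2 * (-t) ^ 1) < 0 := by
    refine mul_neg_of_pos_of_neg h1 ?_
    have : 0 < t ^ 3 * (-v) + e₁ * e₃ ^ 2 * t := by positivity
    rw [F1]; linarith
  have T2 : a 2 * (t ^ 3 * F 2 + e₁ * e₃ ^ 2 * (-t) ^ 2) < 0 := by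
    refine mul_neg_of_neg_of_pos h2 ?_
    have : 0 < e₁ * e₃ ^ 2 * t ^ 2 := by positivity
    rw [F2]; linarith
  have T3 : a 3 * (t ^ 3 * F 3 + e₁ * e₃ ^ 2 * (-t) ^ 3) = 0 := by
    rw [F3]; ring
  have T4 : a 4 * (t ^ 3 * F 4 + e₁ * e₃ ^ 2 * (-t) ^ 4) < 0 := by
    refine mul_neg_of_neg_of_pos h4 ?_
    have : 0 < t ^ 3 * (e₃ ^ 2 * (t ^ 2 + e₂)) + e₁ * e₃ ^ 2 * t ^ 4 := by positivity
    rw [F4]; linarith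
  have T5 : a 5 * (t ^ 3 * F 5 + e₁ * e₃ ^ 2 * (-t) ^ 5) = 0 := by
    rw [F5]; ring
  have T6 : a 6 * (t ^ 3 * F 6 + e₁ * e₃ ^ 2 * (-t) ^ 6) < 0 := by
    refine mul_neg_of_pos_of_neg h6 ?_
    rw [F6]
    linear_combination mul_pos (mul_pos (pow_pos htpos 3) (pow_pos he₃pos 2)) w6
  have T7 : a 7 * (t ^ 3 * F 7 + e₁ * e₃ ^ 2 * (-t) ^ 7) < 0 := by
    refine mul_neg_of_pos_of_neg h7 ?_
    have : 0 < e₁ * e₃ ^ 2 * t ^ 7 := by positivity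
    rw [F7]
    linear_combination mul_pos (mul_pos (pow_pos htpos 3) (pow_pos he₃pos 2)) w7 + this
  have T8 : a 8 * (t ^ 3 * F 8 + e₁ * e₃ ^ 2 * (-t) ^ 8) < 0 := by
    refine mul_neg_of_pos_of_neg h8 ?_
    rw [F8]
    linear_combination mul_pos (mul_pos (pow_pos htpos 3) (pow_pos he₃pos 2)) w8
  refine neg_of_mul_neg_right (a := e₁ * e₃ ^ 2) ?_ (by positivity)
  rw [hident]
  simp only [Finset.sum_range_succ, Finset.sum_range_zero]
  linarith

/-- A real polynomial that is positive at `0` and has no negative root is positive on the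
negative half-line. -/
lemma eval_pos_of_forall_neg_eval_ne_zero {P : Polynomial ℝ} (h0 : 0 < P.eval 0)
    (hP : ∀ x : ℝ, x < 0 → P.eval x ≠ 0) {x : ℝ} (hx : x < 0) : 0 < P.eval x := by
  by_contra! h
  obtain ⟨c, hc, hc0⟩ := intermediate_value_Icc hx.le P.continuous.continuousOn ⟨h, h0.le⟩
  rcases hc.2.lt_or_eq with hlt | rfl
  · exact hP c hlt hc0
  · exact h0.ne' hc0

/-- The given sign pattern is not realizable with the admissible pair (4,0):
there is no degree 8 real polynomial defining this pattern, with no negative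
real roots and exactly four positive real roots, each simple. -/
theorem stmt3 :
    ¬ ∃ P : Polynomial ℝ, P.degree = 8 ∧
      definesSignPattern P ![1, 1, 1, -1, -1, 1, -1, 1, 1] ∧
      (∀ x : ℝ, x < 0 → P.eval x ≠ 0) ∧
      ∃ z : Fin 4 → ℝ, StrictMono z ∧ (∀ i, 0 < z i) ∧
        (∀ i, P.eval (z i) = 0) ∧ (∀ i, P.rootMultiplicity (z i) = 1) ∧
        (∀ x : ℝ, 0 < x → P.eval x = 0 → ∃ i, x = z i) := by
  rintro ⟨P, hdeg, hσ, hneg, z, hz, hzpos, hroot, -, -⟩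
  have pos_of_sign {r : ℝ} (h : Real.sign r = 1) : 0 < r := by
    rcases lt_trichotomy r 0 with hr | rfl | hr
    · rw [Real.sign_of_neg hr] at h; norm_num at h
    · simp at h
    · exact hr
  have neg_of_sign {r : ℝ} (h : Real.sign r = -1) : r < 0 := by
    rcases lt_trichotomy r 0 with hr | rfl | hr
    · exact hr
    · simp at h
    · rw [Real.sign_of_pos hr] at h; norm_num at h
  have heval (r : ℝ) : P.eval r = ∑ k ∈ Finset.range 9, P.coeff k * r ^ k :=
    eval_eq_sum_range' (by rw [natDegree_eq_of_degree_eq_some hdeg]; norm_num) r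
  have c0 : 0 < P.coeff 0 := pos_of_sign (hσ 8)
  have hlt := sum_coeff_neg_of_three_pos_roots (hzpos 0) (hz (show (0 : Fin 4) < 1 by decide))
    (hz (show (1 : Fin 4) < 2 by decide)) P.coeff c0 (pos_of_sign (hσ 7)) (neg_of_sign (hσ 6))
    (neg_of_sign (hσ 4)) (pos_of_sign (hσ 2))
    (pos_of_sign (hσ 1)) (pos_of_sign (hσ 0))
    ((heval _).symm.trans (hroot 0)) ((heval _).symm.trans (hroot 1))
    ((heval _).symm.trans (hroot 2))
  rw [← heval] at hlt
  refine hlt.not_gt (eval_pos_of_forall_neg_eval_ne_zero ?_ hneg ?_)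
  · rwa [← Polynomial.coeff_zero_eq_eval_zero]
  · have := hzpos 0
    have := hzpos 1
    linarith
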